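/- Let f : G → G be a graph map and let K be a connected closed subset of G with f(K) ∩ K ≠ ∅. If K ∩ EP(f) = ∅ and K ∩ Ω(f) ≠ ∅, then there exists n ≥ 1 such that O(K,f) = O_n(K,f); in particular the orbit O(K,f) is closed in G. -/

import Mathlib

open Set Function Filter Topology Metric

noncomputable section

/-- An open arc: a subspace homeomorphic to the open interval `(0,1)`. -/
def IsOpenArc {G : Type*} [TopologicalSpace G] (A : Set G) : Prop :=
  Nonempty (A ≃ₜ Set.Ioo (0 : ℝ) 1)

/-- A circle: a subspace homeomorphic to the unit circle. -/
def IsCircle {G : Type*} [TopologicalSpace G] (C : Set G) : Prop :=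
  Nonempty (C ≃ₜ Metric.sphere (0 : ℂ) 1)

/-- A (topological) graph: a non-degenerate compact connected metric space with a finite
vertex set `V` such that every connected component of the complement of `V` is an open arc,
and every circle contains at least three vertices. -/
structure IsTopGraph {G : Type*} [MetricSpace G] (V : Set G) : Prop where
  nontrivial : Nontrivial G
  compact : CompactSpace G
  connected : ConnectedSpace G
  finite_vertexSet : V.Finite
  component_openArc : ∀ x ∈ Vᶜ, IsOpenArc (connectedComponentIn Vᶜ x)
  circle_vertices : ∀ C : Set G, IsCircle C → 3 ≤ (C ∩ V).ncard

/-- The set of eventually periodic points: points with finite orbit. -/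
def evPeriodicPts {G : Type*} (f : G → G) : Set G :=
  {x | (Set.range fun n : ℕ => f^[n] x).Finite}

/-- `EP_n(f)`: points whose orbit contains at most `n` points. -/
def evPeriodicPtsLe {G : Type*} (f : G → G) (n : ℕ) : Set G :=
  {x | (Set.range fun i : ℕ => f^[i] x).encard ≤ n}

/-- The ω-limit set of a point `x` under `f`. -/
def omegaSet {G : Type*} [TopologicalSpace G] (f : G → G) (x : G) : Set G :=
  ⋂ i : ℕ, closure (Set.range fun n : ℕ => f^[n + i] x)

/-- The ω-limit set of `f`. -/
def omegaLimitSet {G : Type*} [TopologicalSpace G] (f : G → G) : Set G :=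
  ⋃ x : G, omegaSet f x

/-- The set of recurrent points of `f`. -/
def recurrentPts {G : Type*} [TopologicalSpace G] (f : G → G) : Set G :=
  {x | x ∈ omegaSet f x}

/-- The set of non-wandering points of `f`. -/
def nonwanderingPts {G : Type*} [TopologicalSpace G] (f : G → G) : Set G :=
  {x | ∀ U : Set G, IsOpen U → x ∈ U → ∃ n : ℕ, 0 < n ∧ (f^[n] '' U ∩ U).Nonempty}

/-- The set of almost periodic points of `f`. -/
def almostPeriodicPts {G : Type*} [TopologicalSpace G] (f : G → G) : Set G :=
  {x | ∀ U : Set G, IsOpen U → x ∈ U →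
    ∃ m : ℕ, 0 < m ∧ ∀ n : ℕ, ∃ i : ℕ, 1 ≤ i ∧ i ≤ m ∧ f^[n + i] x ∈ U}

/-- The ω-limit set of `x` under the restriction `f|K` (closures taken in the subspace `K`). -/
def omegaSetIn {G : Type*} [TopologicalSpace G] (f : G → G) (K : Set G) (x : G) : Set G :=
  ⋂ i : ℕ, (closure (Set.range fun n : ℕ => f^[n + i] x) ∩ K)

/-- The ω-limit set `ω(f|K)` of the restriction of `f` to `K`. -/
def omegaLimitSetIn {G : Type*} [TopologicalSpace G] (f : G → G) (K : Set G) : Set G :=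
  ⋃ x ∈ K, omegaSetIn f K x

/-- The non-wandering set `Ω(f|K)` of the restriction of `f` to `K`. -/
def nonwanderingPtsIn {G : Type*} [TopologicalSpace G] (f : G → G) (K : Set G) : Set G :=
  {x | x ∈ K ∧ ∀ U : Set G, IsOpen U → x ∈ U →
    ∃ n : ℕ, 0 < n ∧ (f^[n] '' (U ∩ K) ∩ (U ∩ K)).Nonempty}

/-- The almost periodic set `AP(f|K)` of the restriction of `f` to `K`. -/
def almostPeriodicPtsIn {G : Type*} [TopologicalSpace G] (f : G → G) (K : Set G) : Set G :=
  {x | x ∈ K ∧ ∀ U : Set G, IsOpen U → x ∈ U →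
    ∃ m : ℕ, 0 < m ∧ ∀ n : ℕ, ∃ i : ℕ, 1 ≤ i ∧ i ≤ m ∧ f^[n + i] x ∈ U}

/-- The orbit `O(K,f)` of a set `K` under `f`. -/
def setOrbit {G : Type*} (f : G → G) (K : Set G) : Set G := ⋃ i : ℕ, f^[i] '' K

/-- The orbit segment `O_n(K,f)`. -/
def setOrbitSeg {G : Type*} (f : G → G) (K : Set G) (n : ℕ) : Set G :=
  ⋃ i ≤ n, f^[i] '' K

/-- The inverse orbit (absorbed set) `O₋(K,f)`. -/
def invOrbit {G : Type*} (f : G → G) (K : Set G) : Set G := ⋃ i : ℕ, f^[i] ⁻¹' K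

/-- The main absorbed set `Ab(K,f)`: the union of the connected components of `O₋(K,f)`
that meet `K`. -/
def mainAbsorbed {G : Type*} [TopologicalSpace G] (f : G → G) (K : Set G) : Set G :=
  ⋃ x ∈ K, connectedComponentIn (invOrbit f K) x

/-- A minimal set of `f`: nonempty, closed, invariant, with no proper such subset. -/
def IsMinimalSet {G : Type*} [TopologicalSpace G] (f : G → G) (M : Set G) : Prop :=
  M.Nonempty ∧ IsClosed M ∧ f '' M ⊆ M ∧
    ∀ N : Set G, N ⊆ M → N.Nonempty → IsClosed N → f '' N ⊆ N → N = M

open Classical in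
/-- The valence of a point `x` in a metric space: the limit, as `r → 0⁺`, of the number of
boundary points of the ball `B(x,r)` (defined as the eventual value, if it exists). -/
def valence {G : Type*} [MetricSpace G] (x : G) : ℕ :=
  if h : ∃ n : ℕ, ∀ᶠ r in nhdsWithin (0 : ℝ) (Set.Ioi 0),
      (frontier (Metric.ball x r)).ncard = n
  then h.choose else 0

/-- The set of branching points. -/
def branchPts (G : Type*) [MetricSpace G] : Set G := {x | 2 < valence x}

/-- The total branching number `ξ(U)` of a subset `U` of `G`. -/
def totalBranch {G : Type*} [MetricSpace G] (U : Set G) : ℕ :=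
  ∑ᶠ v ∈ U ∩ branchPts G, (valence v - 2)

/-- Cyclic successor on `Fin k`. -/
def finSucc {k : ℕ} (i : Fin k) : Fin k := ⟨(i.1 + 1) % k, Nat.mod_lt _ i.pos⟩

/-- `C : Fin k → Set G` enumerates the connected components of `X`, and `f` maps each
component into the (cyclically) next one. -/
def IsCyclicDecomp {G : Type*} [TopologicalSpace G] (f : G → G) (X : Set G)
    {k : ℕ} (C : Fin k → Set G) : Prop :=
  (⋃ i, C i) = X ∧ (∀ i, (C i).Nonempty) ∧
  (∀ i, ∀ x ∈ C i, connectedComponentIn X x = C i) ∧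
  Function.Injective C ∧ ∀ i, f '' C i ⊆ C (finSucc i)

/-- A component-cyclic `f`-invariant set. -/
def ComponentCyclic {G : Type*} [TopologicalSpace G] (f : G → G) (X : Set G) : Prop :=
  ∃ (k : ℕ) (C : Fin k → Set G), 0 < k ∧ IsCyclicDecomp f X C

/-- `A` is a connected component of `S`. -/
def IsCompOf {G : Type*} [TopologicalSpace G] (A S : Set G) : Prop :=
  ∃ x ∈ S, connectedComponentIn S x = A

/-- The distance between two sets. -/
def setDist {G : Type*} [MetricSpace G] (A B : Set G) : ℝ :=
  sInf {r : ℝ | ∃ a ∈ A, ∃ b ∈ B, dist a b = r}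

end

section Circles

variable {G : Type*} [MetricSpace G]

/-- The image of a closed loop that is injective apart from its endpoints is a circle. -/
lemma isCircle_image_of_loop {c : ℝ → G} {p : ℝ} (hp : 0 < p) (hc : ContinuousOn c (Icc 0 p))
    (hloop : c 0 = c p) (hinj : InjOn c (Ico 0 p)) : IsCircle (c '' Ico 0 p) := by
  have : Fact (0 < p) := ⟨hp⟩
  set g : AddCircle p → G := AddCircle.liftIco p 0 c with hg
  have hgc : Continuous g := AddCircle.liftIco_zero_continuous hloop hc
  have hrep : ∀ q : AddCircle p, ∃ x ∈ Ico 0 p, (x : AddCircle p) = q := by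
    intro q
    have : q ∈ ((↑) : ℝ → AddCircle p) '' Ico 0 (0 + p) := by
      rw [AddCircle.coe_image_Ico_eq]; trivial
    simpa using this
  have hginj : Injective g := by
    intro q r hqr
    obtain ⟨x, hx, rfl⟩ := hrep q
    obtain ⟨y, hy, rfl⟩ := hrep r
    rw [hg, AddCircle.liftIco_zero_coe_apply hx, AddCircle.liftIco_zero_coe_apply hy] at hqr
    rw [hinj hx hy hqr]
  have hrange : range g = c '' Ico 0 p := by
    ext z
    constructor
    · rintro ⟨q, rfl⟩
      obtain ⟨x, hx, rfl⟩ := hrep q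
      exact ⟨x, hx, (AddCircle.liftIco_zero_coe_apply hx).symm⟩
    · rintro ⟨x, hx, rfl⟩
      exact ⟨x, AddCircle.liftIco_zero_coe_apply hx⟩
  rw [← hrange]
  have hemb : IsEmbedding g := (hgc.isClosedEmbedding hginj).isEmbedding
  exact ⟨hemb.toHomeomorph.symm.trans (AddCircle.homeomorphCircle hp.ne')⟩

/-- A map all of whose cluster points lie in a finite set, and which has arbitrarily late
connected tails, converges to a point of that set. -/
lemma exists_tendsto_of_mapClusterPt_mem_finite [CompactSpace G] {ι : Type*} {l : Filter ι}
    [l.NeBot] {φ : ι → G} {V : Set G} (hV : V.Finite)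
    (hconn : ∀ S ∈ l, ∃ S' ∈ l, S' ⊆ S ∧ IsPreconnected (φ '' S'))
    (hcl : ∀ y, MapClusterPt y l φ → y ∈ V) : ∃ v ∈ V, Tendsto φ l (𝓝 v) := by
  obtain ⟨v, -, hv⟩ := isCompact_univ (f := map φ l) (by simp)
  replace hv : MapClusterPt v l φ := hv
  refine ⟨v, hcl v hv, ?_⟩
  intro A hA
  obtain ⟨A₁, hA₁A, hA₁, hvA₁⟩ := _root_.mem_nhds_iff.1 hA
  obtain ⟨A₂, B, hA₂, hB, hvA₂, hVB, hAB⟩ :=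
    SeparatedNhds.of_isCompact_isCompact (isCompact_singleton (x := v))
      (hV.subset (sdiff_subset (t := {v}))).isCompact disjoint_sdiff_right
  have hmem : (A₁ ∩ A₂) ∪ B ∈ map φ l := by
    refine isCompact_univ.adherence_nhdset (by simp) ((hA₁.inter hA₂).union hB) ?_
    intro x _ hx
    by_cases hxv : x = v
    · exact Or.inl ⟨hxv ▸ hvA₁, hvA₂ hxv⟩
    · exact Or.inr (hVB ⟨hcl x hx, hxv⟩)
  obtain ⟨S, hS, hSsub, hSconn⟩ := hconn _ hmem
  have hmeet : (φ '' S ∩ (A₁ ∩ A₂)).Nonempty := by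
    obtain ⟨t, ht, htS⟩ := ((mapClusterPt_iff_frequently.1 hv _
      ((hA₁.inter hA₂).mem_nhds ⟨hvA₁, hvA₂ rfl⟩)).and_eventually hS).exists
    exact ⟨φ t, ⟨t, htS, rfl⟩, ht⟩
  have hsub := hSconn.subset_left_of_subset_union (hA₁.inter hA₂) hB
    (hAB.mono_left inter_subset_right) (image_subset_iff.2 hSsub) hmeet
  have hSA : S ⊆ φ ⁻¹' A := fun t ht => hA₁A (hsub ⟨t, ht, rfl⟩).1
  exact mem_map.2 (mem_of_superset hS hSA)

/-- An open arc whose closure only adds points of a finite set extends to a path on `[0,1]`. -/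
lemma exists_arc_of_isEmbedding [CompactSpace G] {V : Set G} (hV : V.Finite)
    {γ : Ioo (0 : ℝ) 1 → G} (hγ : IsEmbedding γ) (hcl : closure (range γ) ⊆ range γ ∪ V) :
    ∃ c : ℝ → G, ContinuousOn c (Icc 0 1) ∧ InjOn c (Ioo 0 1) ∧ c '' Ioo 0 1 = range γ ∧
      c 0 ∈ V ∧ c 1 ∈ V := by
  have hhalf : (1 / 2 : ℝ) ∈ Ioo (0 : ℝ) 1 := by norm_num
  set φ : ℝ → G := extend Subtype.val γ (fun _ => γ ⟨1 / 2, hhalf⟩) with hφdef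
  have hφ : ∀ t : Ioo (0 : ℝ) 1, φ t = γ t := fun t => Subtype.val_injective.extend_apply _ _ t
  have hφc : ContinuousOn φ (Ioo 0 1) := by
    rw [continuousOn_iff_continuous_domRestrict]
    convert hγ.continuous using 1
    ext t
    exact hφ t
  have hlim : ∀ l : Filter ℝ, l.NeBot → Ioo (0 : ℝ) 1 ∈ l →
      (∀ S ∈ l, ∃ S' ∈ l, S' ⊆ S ∧ IsPreconnected S') →
      (∀ s ∈ Ioo (0 : ℝ) 1, Disjoint (𝓝 s) l) → ∃ v ∈ V, Tendsto φ l (𝓝 v) := by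
    intro l _ hl hlconn hdisj
    apply exists_tendsto_of_mapClusterPt_mem_finite hV
    · intro S hS
      obtain ⟨S', hS', hsub, hpre⟩ := hlconn _ (inter_mem hS hl)
      exact ⟨S', hS', fun x hx => (hsub hx).1,
        hpre.image φ (hφc.mono fun x hx => (hsub hx).2)⟩
    · intro y hy
      have hycl : y ∈ closure (range γ) := by
        rw [mem_closure_iff_nhds]
        intro W hW
        obtain ⟨t, htW, ht⟩ := ((mapClusterPt_iff_frequently.1 hy W hW).and_eventually hl).exists
        exact ⟨φ t, htW, ⟨t, ht⟩, (hφ ⟨t, ht⟩).symm⟩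
      rcases hcl hycl with ⟨s, rfl⟩ | h
      · exfalso
        obtain ⟨A, hA, B, hB, hAB⟩ := Filter.disjoint_iff.1 (hdisj s s.2)
        have hA' : Subtype.val ⁻¹' A ∈ 𝓝 s := continuous_subtype_val.continuousAt hA
        rw [hγ.nhds_eq_comap, mem_comap] at hA'
        obtain ⟨W, hW, hWA⟩ := hA'
        obtain ⟨t, htW, ht, htB⟩ := ((mapClusterPt_iff_frequently.1 hy W hW).and_eventually
          (inter_mem hl hB)).exists
        have h1 : γ ⟨t, ht⟩ ∈ W := by rw [← hφ ⟨t, ht⟩]; exact htW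
        exact disjoint_left.1 hAB (hWA h1) htB
      · exact h
  obtain ⟨v, hv, hv0⟩ := hlim (𝓝[>] 0) inferInstance (Ioo_mem_nhdsGT one_pos)
    (fun S hS => by
      obtain ⟨u, hu, hus⟩ := (mem_nhdsGT_iff_exists_Ioo_subset).1 hS
      exact ⟨Ioo 0 u, Ioo_mem_nhdsGT hu, hus, isPreconnected_Ioo⟩)
    (fun s hs => (disjoint_nhds_nhds.2 hs.1.ne').mono_right nhdsWithin_le_nhds)
  obtain ⟨w, hw, hw1⟩ := hlim (𝓝[<] 1) inferInstance (Ioo_mem_nhdsLT one_pos)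
    (fun S hS => by
      obtain ⟨u, hu, hus⟩ := (mem_nhdsLT_iff_exists_Ioo_subset).1 hS
      exact ⟨Ioo u 1, Ioo_mem_nhdsLT hu, hus, isPreconnected_Ioo⟩)
    (fun s hs => (disjoint_nhds_nhds.2 hs.2.ne).mono_right nhdsWithin_le_nhds)
  have heq : EqOn (extendFrom (Ioo 0 1) φ) φ (Ioo 0 1) := fun t ht =>
    extendFrom_eq (subset_closure ht) (hφc t ht)
  refine ⟨extendFrom (Ioo 0 1) φ, continuousOn_Icc_extendFrom_Ioo hφc hv0 hw1, ?_, ?_, ?_, ?_⟩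
  · intro s hs t ht hst
    rw [heq hs, heq ht] at hst
    have := hγ.injective ((hφ ⟨s, hs⟩).symm.trans (hst.trans (hφ ⟨t, ht⟩)))
    simpa using this
  · rw [heq.image_eq]
    ext z
    constructor
    · rintro ⟨t, ht, rfl⟩
      exact ⟨⟨t, ht⟩, (hφ ⟨t, ht⟩).symm⟩
    · rintro ⟨t, rfl⟩
      exact ⟨t, t.2, hφ t⟩
  · rw [eq_lim_at_left_extendFrom_Ioo one_pos hv0]; exact hv
  · rw [eq_lim_at_right_extendFrom_Ioo one_pos hw1]; exact hw

end Circles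

section Atlas

variable {G : Type*} [MetricSpace G]

/-- Two disjoint open arcs with the same pair of end vertices would form a circle with at most
two vertices. -/
lemma IsTopGraph.false_of_parallel_arcs {V : Set G} (hG : IsTopGraph V) {c d : ℝ → G}
    (hc : ContinuousOn c (Icc 0 1)) (hd : ContinuousOn d (Icc 0 1)) (hci : InjOn c (Ioo 0 1))
    (hdi : InjOn d (Ioo 0 1)) (hcV : ∀ t ∈ Ioo (0 : ℝ) 1, c t ∉ V)
    (hdV : ∀ t ∈ Ioo (0 : ℝ) 1, d t ∉ V)
    (hcd : ∀ s ∈ Ioo (0 : ℝ) 1, ∀ t ∈ Ioo (0 : ℝ) 1, c s ≠ d t)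
    (hc0 : c 0 ∈ V) (hc1 : c 1 ∈ V) (h0 : c 0 = d 0) (h1 : c 1 = d 1) (h01 : c 0 ≠ c 1) :
    False := by
  classical
  set e : ℝ → G := fun t => if t ≤ 1 then c t else d (2 - t) with he
  have hec : ContinuousOn e (Icc 0 2) := by
    have h2 : Icc (0 : ℝ) 2 = Icc 0 1 ∪ Icc 1 2 :=
      (Icc_union_Icc_eq_Icc (by norm_num) (by norm_num)).symm
    rw [h2]
    refine ContinuousOn.union_of_isClosed ?_ ?_ isClosed_Icc isClosed_Icc
    · exact hc.congr fun t ht => if_pos ht.2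
    · have : ContinuousOn (fun t => d (2 - t)) (Icc (1 : ℝ) 2) :=
        hd.comp (by fun_prop) fun t ht => ⟨by linarith [ht.2], by linarith [ht.1]⟩
      refine this.congr fun t ht => ?_
      rcases eq_or_lt_of_le ht.1 with rfl | h
      · simp only [he, le_refl, if_true, h1]; norm_num
      · exact if_neg (not_le.2 h)
  have key : ∀ t ∈ Ico (0 : ℝ) 2, (t = 0 ∧ e t = c 0) ∨ (t ∈ Ioo (0 : ℝ) 1 ∧ e t = c t) ∨
      (t = 1 ∧ e t = c 1) ∨ (∃ u ∈ Ioo (0 : ℝ) 1, t = 2 - u ∧ e t = d u) := by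
    intro t ht
    rcases eq_or_lt_of_le ht.1 with rfl | h
    · exact Or.inl ⟨rfl, if_pos zero_le_one⟩
    rcases lt_trichotomy t 1 with h' | rfl | h'
    · exact Or.inr (Or.inl ⟨⟨h, h'⟩, if_pos h'.le⟩)
    · exact Or.inr (Or.inr (Or.inl ⟨rfl, if_pos le_rfl⟩))
    · exact Or.inr (Or.inr (Or.inr ⟨2 - t, ⟨by linarith [ht.2], by linarith⟩, by ring,
        if_neg (not_le.2 h')⟩))
  have hinj : InjOn e (Ico 0 2) := by
    intro s hs t ht hst
    rcases key s hs with ⟨rfl, h⟩ | ⟨h', h⟩ | ⟨rfl, h⟩ | ⟨u, hu, rfl, h⟩ <;>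
      rcases key t ht with ⟨rfl, k⟩ | ⟨k', k⟩ | ⟨rfl, k⟩ | ⟨v, hv, rfl, k⟩ <;>
      first | rfl | (rw [h, k] at hst; grind [InjOn])
  have hcirc := isCircle_image_of_loop two_pos hec
    (by simp only [he, zero_le_one, if_true]; norm_num [h0]) hinj
  have h3 := hG.circle_vertices _ hcirc
  have hsub : e '' Ico 0 2 ∩ V ⊆ {c 0, c 1} := by
    rintro _ ⟨⟨t, ht, rfl⟩, htV⟩
    rcases key t ht with ⟨-, h⟩ | ⟨h', h⟩ | ⟨-, h⟩ | ⟨u, hu, -, h⟩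
    · simp [h]
    · exact absurd (h ▸ htV) (hcV t h')
    · simp [h]
    · exact absurd (h ▸ htV) (hdV u hu)
  have := (ncard_le_ncard hsub (by simp)).trans (ncard_pair h01).le
  omega

/-- An open arc with both ends at the same vertex would form a circle with one vertex. -/
lemma IsTopGraph.arc_ends_ne {V : Set G} (hG : IsTopGraph V) {c : ℝ → G}
    (hc : ContinuousOn c (Icc 0 1)) (hci : InjOn c (Ioo 0 1))
    (hcV : ∀ t ∈ Ioo (0 : ℝ) 1, c t ∉ V) (hc0 : c 0 ∈ V) : c 0 ≠ c 1 := by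
  intro h01
  have key : ∀ t ∈ Ico (0 : ℝ) 1, t = 0 ∨ t ∈ Ioo (0 : ℝ) 1 := fun t ht =>
    (eq_or_lt_of_le ht.1).imp (fun h => h.symm) fun h => ⟨h, ht.2⟩
  have hinj : InjOn c (Ico 0 1) := by
    intro s hs t ht hst
    rcases key s hs with rfl | h <;> rcases key t ht with rfl | k <;> grind [InjOn]
  have h3 := hG.circle_vertices _ (isCircle_image_of_loop one_pos hc h01 hinj)
  have hsub : c '' Ico 0 1 ∩ V ⊆ {c 0} := by
    rintro _ ⟨⟨t, ht, rfl⟩, htV⟩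
    rcases key t ht with rfl | h
    · rfl
    · exact absurd htV (hcV t h)
  have := (ncard_le_ncard hsub (by simp)).trans (ncard_singleton _).le
  omega

/-- A finite set `V` and finitely many disjoint open edges, parametrized by the real line,
which together make up the space. -/
structure IsEdgeAtlas (V : Set G) (𝓔 : Set (ℝ → G)) : Prop where
  finite_vertices : V.Finite
  finite_edges : 𝓔.Finite
  isOpenEmbedding : ∀ φ ∈ 𝓔, IsOpenEmbedding φ
  eq_of_apply_eq : ∀ φ ∈ 𝓔, ∀ ψ ∈ 𝓔, ∀ s t, φ s = ψ t → φ = ψ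
  apply_notMem : ∀ φ ∈ 𝓔, ∀ t, φ t ∉ V
  cover : ∀ x ∉ V, ∃ φ ∈ 𝓔, ∃ t, φ t = x

/-- A topological graph has an edge atlas. -/
lemma IsTopGraph.exists_isEdgeAtlas {V : Set G} (hG : IsTopGraph V) :
    ∃ 𝓔, IsEdgeAtlas V 𝓔 := by
  classical
  have := hG.compact
  have : Nonempty G := hG.nontrivial.to_nonempty
  have hV := hG.finite_vertexSet
  set 𝓒 : Set (Set G) := {E | ∃ x ∈ Vᶜ, connectedComponentIn Vᶜ x = E} with h𝓒
  have hCV : ∀ E ∈ 𝓒, ∀ y ∈ E, y ∉ V := by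
    rintro _ ⟨x, hx, rfl⟩ y hy
    exact connectedComponentIn_subset _ _ hy
  have heq : ∀ E ∈ 𝓒, ∀ F ∈ 𝓒, ∀ y, y ∈ E → y ∈ F → E = F := by
    rintro _ ⟨x, hx, rfl⟩ _ ⟨z, hz, rfl⟩ y hy hy'
    rw [connectedComponentIn_eq hy, connectedComponentIn_eq hy']
  have hclos : ∀ E ∈ 𝓒, closure E ⊆ E ∪ V := by
    rintro _ ⟨x, hx, rfl⟩ y hy
    by_cases hyV : y ∈ V
    · exact Or.inr hyV
    left
    have hpre : IsPreconnected (insert y (connectedComponentIn Vᶜ x)) :=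
      isPreconnected_connectedComponentIn.subset_closure (subset_insert _ _)
        (insert_subset hy subset_closure)
    exact hpre.subset_connectedComponentIn
      (mem_insert_of_mem _ (mem_connectedComponentIn hx))
      (insert_subset hyV (connectedComponentIn_subset _ _)) (mem_insert _ _)
  have harc : ∀ E ∈ 𝓒, ∃ γ : Ioo (0 : ℝ) 1 → G, IsEmbedding γ ∧ range γ = E := by
    rintro _ ⟨x, hx, rfl⟩
    obtain ⟨e⟩ := hG.component_openArc x hx
    refine ⟨Subtype.val ∘ e.symm, IsEmbedding.subtypeVal.comp e.symm.isEmbedding, ?_⟩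
    rw [range_comp, e.symm.surjective.range_eq, image_univ, Subtype.range_val]
  have hpath : ∀ E : Set G, ∃ c : ℝ → G, E ∈ 𝓒 → ContinuousOn c (Icc 0 1) ∧
      InjOn c (Ioo 0 1) ∧ c '' Ioo 0 1 = E ∧ c 0 ∈ V ∧ c 1 ∈ V := by
    intro E
    by_cases hE : E ∈ 𝓒
    · obtain ⟨γ, hγ, rfl⟩ := harc E hE
      obtain ⟨c, hc⟩ := exists_arc_of_isEmbedding hV hγ (hclos _ hE)
      exact ⟨c, fun _ => hc⟩
    · exact ⟨fun _ => Classical.arbitrary G, fun h => absurd h hE⟩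
  choose c hc using hpath
  have hcV : ∀ E ∈ 𝓒, ∀ t ∈ Ioo (0 : ℝ) 1, c E t ∉ V := fun E hE t ht =>
    hCV E hE _ ((hc E hE).2.2.1.subset (mem_image_of_mem (c E) ht))
  have hfin : 𝓒.Finite := by
    refine Finite.of_injOn (f := fun E => (c E 0, c E 1)) (t := V ×ˢ V)
      (fun E hE => ⟨(hc E hE).2.2.2.1, (hc E hE).2.2.2.2⟩) ?_ (hV.prod hV)
    intro E hE F hF hEF
    obtain ⟨h0, h1⟩ := Prod.mk.inj hEF
    by_contra hne
    obtain ⟨hcE, hiE, himE, hE0, hE1⟩ := hc E hE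
    obtain ⟨hcF, hiF, himF, hF0, hF1⟩ := hc F hF
    refine hG.false_of_parallel_arcs hcE hcF hiE hiF (hcV E hE) (hcV F hF) ?_ hE0 hE1 h0 h1
      (hG.arc_ends_ne hcE hiE (hcV E hE) hE0)
    intro s hs t ht hst
    exact hne (heq E hE F hF (c E s) (himE.subset (mem_image_of_mem _ hs))
      (hst ▸ himF.subset (mem_image_of_mem _ ht)))
  have hopen : ∀ E ∈ 𝓒, IsOpen E := by
    intro E hE
    have hcl : IsClosed (V ∪ ⋃ F ∈ 𝓒 \ {E}, closure F) :=
      hV.isClosed.union ((hfin.subset sdiff_subset).isClosed_biUnion fun _ _ => isClosed_closure)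
    convert hcl.isOpen_compl using 1
    ext y
    constructor
    · rintro hy (hyV | hy')
      · exact hCV E hE y hy hyV
      · obtain ⟨F, ⟨hF, hFE⟩, hyF⟩ := mem_iUnion₂.1 hy'
        rcases hclos F hF hyF with h | h
        · exact hFE (heq F hF E hE y h hy)
        · exact hCV E hE y hy h
    · intro hy
      have hyV : y ∈ Vᶜ := fun h => hy (Or.inl h)
      by_contra hyE
      refine hy (Or.inr (mem_iUnion₂.2 ⟨connectedComponentIn Vᶜ y, ⟨⟨y, hyV, rfl⟩, ?_⟩,
        subset_closure (mem_connectedComponentIn hyV)⟩))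
      rintro rfl
      exact hyE (mem_connectedComponentIn hyV)
  have hline : ∀ E ∈ 𝓒, ∃ φ : ℝ → G, IsOpenEmbedding φ ∧ range φ = E := by
    intro E hE
    obtain ⟨γ, hγ, hr⟩ := harc E hE
    have hs : ∀ t, Real.sigmoid t ∈ Ioo (0 : ℝ) 1 := fun t =>
      ⟨Real.sigmoid_pos t, Real.sigmoid_lt_one t⟩
    have hemb : IsEmbedding Real.sigmoid :=
      Real.sigmoid_strictMono.isEmbedding_of_ordConnected
        (by rw [Real.range_sigmoid]; exact ordConnected_Ioo)
    have hrange : range (γ ∘ codRestrict Real.sigmoid _ hs) = E := by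
      rw [← hr]
      refine Surjective.range_comp ?_ γ
      rintro ⟨t, ht⟩
      obtain ⟨s, rfl⟩ : t ∈ range Real.sigmoid := Real.range_sigmoid ▸ ht
      exact ⟨s, rfl⟩
    refine ⟨γ ∘ codRestrict Real.sigmoid _ hs, ⟨hγ.comp (hemb.codRestrict _ hs), ?_⟩, hrange⟩
    rw [hrange]
    exact hopen E hE
  choose! φ hφ hrφ using hline
  refine ⟨φ '' 𝓒, hV, hfin.image _, ?_, ?_, ?_, ?_⟩
  · rintro _ ⟨E, hE, rfl⟩
    exact hφ E hE
  · rintro _ ⟨E, hE, rfl⟩ _ ⟨F, hF, rfl⟩ s t hst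
    rw [heq E hE F hF (φ E s) ((hrφ E hE).subset (mem_range_self s))
      (hst ▸ (hrφ F hF).subset (mem_range_self t))]
  · rintro _ ⟨E, hE, rfl⟩ t
    exact hCV E hE _ ((hrφ E hE).subset (mem_range_self t))
  · intro x hx
    have hE : connectedComponentIn Vᶜ x ∈ 𝓒 := ⟨x, hx, rfl⟩
    obtain ⟨t, ht⟩ : x ∈ range (φ (connectedComponentIn Vᶜ x)) :=
      (hrφ _ hE).symm ▸ mem_connectedComponentIn hx
    exact ⟨_, mem_image_of_mem _ hE, t, ht⟩

end Atlas

section Frontier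

variable {G : Type*} [MetricSpace G]

lemma isOpenEmbedding_add_exp (a : ℝ) : IsOpenEmbedding fun t : ℝ => a + Real.exp t :=
  (Homeomorph.addLeft a).isOpenEmbedding.comp Real.isOpenEmbedding_exp

lemma isOpenEmbedding_sub_exp (a : ℝ) : IsOpenEmbedding fun t : ℝ => a - Real.exp t :=
  (Homeomorph.subLeft a).isOpenEmbedding.comp Real.isOpenEmbedding_exp

/-- An edge atlas can be refined by adding one point to the vertex set. -/
lemma IsEdgeAtlas.exists_insert {V : Set G} {𝓔 : Set (ℝ → G)} (h : IsEdgeAtlas V 𝓔) (p : G) :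
    ∃ 𝓔', IsEdgeAtlas (insert p V) 𝓔' := by
  by_cases hp : p ∈ V
  · exact ⟨𝓔, by rwa [insert_eq_of_mem hp]⟩
  obtain ⟨φ, hφ, a, rfl⟩ := h.cover p hp
  have hφi := (h.isOpenEmbedding φ hφ).injective
  have hexp := Real.exp_pos
  refine ⟨(𝓔 \ {φ}) ∪ {fun t => φ (a + Real.exp t), fun t => φ (a - Real.exp t)},
    h.finite_vertices.insert _, (h.finite_edges.subset sdiff_subset).union (by simp),
    ?_, ?_, ?_, ?_⟩
  · rintro ψ (⟨hψ, -⟩ | rfl | rfl)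
    · exact h.isOpenEmbedding ψ hψ
    · exact (h.isOpenEmbedding φ hφ).comp (isOpenEmbedding_add_exp a)
    · exact (h.isOpenEmbedding φ hφ).comp (isOpenEmbedding_sub_exp a)
  · rintro ψ (⟨hψ, hψφ⟩ | rfl | rfl) χ (⟨hχ, hχφ⟩ | rfl | rfl) s t hst
    · exact h.eq_of_apply_eq ψ hψ χ hχ s t hst
    · exact absurd (h.eq_of_apply_eq ψ hψ φ hφ _ _ hst) hψφ
    · exact absurd (h.eq_of_apply_eq ψ hψ φ hφ _ _ hst) hψφ
    · exact absurd (h.eq_of_apply_eq χ hχ φ hφ _ _ hst.symm) hχφ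
    · rfl
    · linarith [hφi hst, hexp s, hexp t]
    · exact absurd (h.eq_of_apply_eq χ hχ φ hφ _ _ hst.symm) hχφ
    · linarith [hφi hst, hexp s, hexp t]
    · rfl
  · rintro ψ (⟨hψ, hψφ⟩ | rfl | rfl) t (ht | ht)
    · exact hψφ (h.eq_of_apply_eq ψ hψ φ hφ _ _ ht)
    · exact h.apply_notMem ψ hψ t ht
    · linarith [hφi ht, hexp t]
    · exact h.apply_notMem φ hφ _ ht
    · linarith [hφi ht, hexp t]
    · exact h.apply_notMem φ hφ _ ht
  · intro x hx
    obtain ⟨hxp, hxV⟩ := not_or.1 hx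
    obtain ⟨ψ, hψ, t, rfl⟩ := h.cover x hxV
    by_cases hψφ : ψ = φ
    · subst hψφ
      rcases lt_trichotomy t a with hta | rfl | hta
      · exact ⟨_, Or.inr (Or.inr rfl), Real.log (a - t), by
          simp [Real.exp_log (sub_pos.2 hta)]⟩
      · exact absurd rfl hxp
      · exact ⟨_, Or.inr (Or.inl rfl), Real.log (t - a), by
          simp [Real.exp_log (sub_pos.2 hta)]⟩
    · exact ⟨ψ, Or.inl ⟨hψ, hψφ⟩, t, rfl⟩

/-- An edge atlas can be refined by adding finitely many points to the vertex set. -/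
lemma IsEdgeAtlas.exists_union {V : Set G} {𝓔 : Set (ℝ → G)} (h : IsEdgeAtlas V 𝓔) {F : Set G}
    (hF : F.Finite) : ∃ 𝓔', IsEdgeAtlas (F ∪ V) 𝓔' := by
  induction F, hF using Set.Finite.induction_on with
  | empty => exact ⟨𝓔, by simpa using h⟩
  | insert _ _ ih =>
    obtain ⟨𝓔', h'⟩ := ih
    rw [insert_union]
    exact h'.exists_insert _

/-- A connected set meets an open edge in an interval or in the complement of an interval. -/
lemma IsPreconnected.ordConnected_preimage_or {C : Set G} (hC : IsPreconnected C) {φ : ℝ → G}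
    (hφ : IsOpenEmbedding φ) : OrdConnected (φ ⁻¹' C) ∨ OrdConnected (φ ⁻¹' C)ᶜ := by
  by_contra! hcon
  obtain ⟨h1, h2⟩ := hcon
  rw [ordConnected_def] at h2
  push Not at h2
  obtain ⟨a, ha, b, hb, hab⟩ := h2
  obtain ⟨r, hr, hrC⟩ := not_subset.1 hab
  have hrC : φ r ∈ C := not_not.1 hrC
  have hra : a ≠ r := by rintro rfl; exact ha hrC
  have hrb : r ≠ b := by rintro rfl; exact hb hrC
  have hsub : C ⊆ φ '' Ioo a b := by
    refine hC.subset_left_of_subset_union (hφ.isOpenMap _ isOpen_Ioo)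
      (isCompact_Icc.image hφ.continuous).isClosed.isOpen_compl
      (disjoint_compl_right.mono_right (compl_subset_compl.2 (image_mono Ioo_subset_Icc_self)))
      ?_ ⟨φ r, hrC, r, ⟨lt_of_le_of_ne hr.1 hra, lt_of_le_of_ne hr.2 hrb⟩, rfl⟩
    intro y hy
    by_cases hyI : y ∈ φ '' Icc a b
    · obtain ⟨t, ht, rfl⟩ := hyI
      refine Or.inl ⟨t, ⟨lt_of_le_of_ne ht.1 ?_, lt_of_le_of_ne ht.2 ?_⟩, rfl⟩
      · rintro rfl; exact ha hy
      · rintro rfl; exact hb hy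
    · exact Or.inr hyI
  exact h1 (hC.preimage_of_isOpenMap hφ.injective hφ.isOpenMap
    (hsub.trans (image_subset_range _ _))).ordConnected

lemma OrdConnected.encard_frontier_le_two {s : Set ℝ} (hs : OrdConnected s) :
    (frontier s).encard ≤ 2 := by
  have key : ∀ p ∈ frontier s, ∀ q ∈ frontier s, ∀ r ∈ frontier s, p < q → q < r → False := by
    intro p hp q hq r hr hpq hqr
    obtain ⟨p', hp', hp's⟩ := mem_closure_iff.1 hp.1 (Iio q) isOpen_Iio hpq
    obtain ⟨r', hr', hr's⟩ := mem_closure_iff.1 hr.1 (Ioi q) isOpen_Ioi hqr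
    exact hq.2 (mem_interior.2 ⟨Ioo p' r', Ioo_subset_Icc_self.trans (hs.out hp's hr's),
      isOpen_Ioo, hp', hr'⟩)
  by_contra! hlt
  obtain ⟨t, hts, ht⟩ := exists_subset_encard_eq (Order.add_one_le_of_lt hlt)
  obtain ⟨a, b, c, hab, hac, hbc, rfl⟩ := encard_eq_three.1 (ht.trans two_add_one_eq_three)
  have ha : a ∈ frontier s := hts (by simp)
  have hb : b ∈ frontier s := hts (by simp)
  have hc : c ∈ frontier s := hts (by simp)
  rcases lt_or_gt_of_ne hab with h1 | h1 <;> rcases lt_or_gt_of_ne hac with h2 | h2 <;>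
    rcases lt_or_gt_of_ne hbc with h3 | h3 <;> grind

/-- The frontiers of connected subsets of a graph have uniformly bounded cardinality. -/
lemma IsEdgeAtlas.exists_encard_frontier_le {V : Set G} {𝓔 : Set (ℝ → G)}
    (h : IsEdgeAtlas V 𝓔) :
    ∃ M : ℕ, ∀ C : Set G, IsPreconnected C → (frontier C).encard ≤ M := by
  have hedges : ∀ 𝓕 : Set (ℝ → G), 𝓕.Finite → 𝓕 ⊆ 𝓔 → ∃ M : ℕ, ∀ C : Set G,
      IsPreconnected C → (frontier C ∩ ⋃ φ ∈ 𝓕, range φ).encard ≤ M := by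
    intro 𝓕 h𝓕
    induction 𝓕, h𝓕 using Set.Finite.induction_on with
    | empty => exact fun _ => ⟨0, fun C _ => by simp⟩
    | @insert φ 𝓕 _ _ ih =>
      intro hsub
      obtain ⟨M, hM⟩ := ih ((subset_insert _ _).trans hsub)
      refine ⟨2 + M, fun C hC => ?_⟩
      have hφ := h.isOpenEmbedding φ (hsub (mem_insert _ _))
      rw [biUnion_insert, inter_union_distrib_left]
      refine (encard_union_le _ _).trans ?_
      push_cast
      refine add_le_add ?_ (hM C hC)
      rw [← image_preimage_eq_inter_range, hφ.injective.encard_image,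
        hφ.isOpenMap.preimage_frontier_eq_frontier_preimage hφ.continuous]
      rcases hC.ordConnected_preimage_or hφ with h1 | h1
      · exact OrdConnected.encard_frontier_le_two h1
      · rw [← frontier_compl]
        exact OrdConnected.encard_frontier_le_two h1
  obtain ⟨M, hM⟩ := hedges 𝓔 h.finite_edges subset_rfl
  refine ⟨V.ncard + M, fun C hC => ?_⟩
  have hsub : frontier C ⊆ V ∪ (frontier C ∩ ⋃ φ ∈ 𝓔, range φ) := by
    intro x hx
    by_cases hxV : x ∈ V
    · exact Or.inl hxV
    · obtain ⟨φ, hφ, t, rfl⟩ := h.cover x hxV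
      exact Or.inr ⟨hx, mem_iUnion₂.2 ⟨φ, hφ, t, rfl⟩⟩
  refine (encard_le_encard hsub).trans ((encard_union_le _ _).trans ?_)
  push_cast
  exact add_le_add h.finite_vertices.cast_ncard_eq.ge (hM C hC)

end Frontier

section Orbits

variable {G : Type*} {f : G → G} {K : Set G}

/-- The part of the orbit of `K` that is not reached within `n` steps. -/
def orbitTail (f : G → G) (K : Set G) (n : ℕ) : Set G := setOrbit f K \ setOrbitSeg f K n

lemma mem_setOrbit {y : G} : y ∈ setOrbit f K ↔ ∃ i, ∃ x ∈ K, f^[i] x = y := by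
  simp [setOrbit]

lemma mem_setOrbitSeg {n : ℕ} {y : G} :
    y ∈ setOrbitSeg f K n ↔ ∃ i ≤ n, ∃ x ∈ K, f^[i] x = y := by
  simp [setOrbitSeg]

lemma setOrbitSeg_mono : Monotone (setOrbitSeg f K) := by
  intro m n hmn y hy
  obtain ⟨i, hi, h⟩ := mem_setOrbitSeg.1 hy
  exact mem_setOrbitSeg.2 ⟨i, hi.trans hmn, h⟩

lemma setOrbitSeg_subset_setOrbit (n : ℕ) : setOrbitSeg f K n ⊆ setOrbit f K := by
  intro y hy
  obtain ⟨i, -, h⟩ := mem_setOrbitSeg.1 hy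
  exact mem_setOrbit.2 ⟨i, h⟩

lemma exists_mem_setOrbitSeg {y : G} (hy : y ∈ setOrbit f K) : ∃ n, y ∈ setOrbitSeg f K n := by
  obtain ⟨i, h⟩ := mem_setOrbit.1 hy
  exact ⟨i, mem_setOrbitSeg.2 ⟨i, le_rfl, h⟩⟩

lemma subset_setOrbit : K ⊆ setOrbit f K := fun x hx => mem_setOrbit.2 ⟨0, x, hx, rfl⟩

lemma orbitTail_antitone : Antitone (orbitTail f K) := fun _ _ h =>
  sdiff_subset_sdiff_right (setOrbitSeg_mono h)

lemma orbitTail_subset (n : ℕ) : orbitTail f K n ⊆ setOrbit f K := sdiff_subset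

lemma iterate_mem_setOrbit {y : G} (hy : y ∈ setOrbit f K) (k : ℕ) :
    f^[k] y ∈ setOrbit f K := by
  obtain ⟨i, x, hx, rfl⟩ := mem_setOrbit.1 hy
  exact mem_setOrbit.2 ⟨k + i, x, hx, iterate_add_apply f k i x⟩

lemma iterate_mem_setOrbitSeg {n : ℕ} {y : G} (hy : y ∈ setOrbitSeg f K n) (k : ℕ) :
    f^[k] y ∈ setOrbitSeg f K (n + k) := by
  obtain ⟨i, hi, x, hx, rfl⟩ := mem_setOrbitSeg.1 hy
  exact mem_setOrbitSeg.2 ⟨k + i, by omega, x, hx, iterate_add_apply f k i x⟩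

lemma exists_mem_orbitTail_apply_eq {n : ℕ} {y : G} (hy : y ∈ orbitTail f K (n + 1)) :
    ∃ z ∈ orbitTail f K n, f z = y := by
  obtain ⟨i, x, hx, rfl⟩ := mem_setOrbit.1 hy.1
  have hi : n + 1 < i := by
    by_contra! h
    exact hy.2 (mem_setOrbitSeg.2 ⟨i, h, x, hx, rfl⟩)
  obtain ⟨j, rfl⟩ : ∃ j, i = j + 1 := ⟨i - 1, by omega⟩
  refine ⟨f^[j] x, ⟨mem_setOrbit.2 ⟨j, x, hx, rfl⟩, fun h => hy.2 ?_⟩,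
    (iterate_succ_apply' f j x).symm⟩
  rw [iterate_succ_apply']
  exact iterate_mem_setOrbitSeg h 1

/-- Points far out in the orbit have preimages under iterates that first occur correspondingly
earlier. -/
lemma exists_iterate_eq_of_mem_orbitTail {n k : ℕ} {y : G} (hy : y ∈ orbitTail f K (n + k)) :
    ∃ m ≥ n, y ∈ orbitTail f K (m + k) ∧
      ∃ z ∈ orbitTail f K m, z ∈ setOrbitSeg f K (m + 1) ∧ f^[k] z = y := by
  classical
  have hex := exists_mem_setOrbitSeg hy.1
  set i := Nat.find hex with hi
  obtain ⟨j, hj, x, hx, hjx⟩ := mem_setOrbitSeg.1 (Nat.find_spec hex)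
  have hij : j = i := le_antisymm hj
    (Nat.find_min' hex (mem_setOrbitSeg.2 ⟨j, le_rfl, x, hx, hjx⟩))
  rw [hij] at hjx
  have hlt : n + k < i := by
    by_contra! h
    exact hy.2 (setOrbitSeg_mono h (Nat.find_spec hex))
  obtain ⟨m, hm⟩ : ∃ m, i = m + 1 + k := ⟨i - 1 - k, by omega⟩
  have hym : y ∉ setOrbitSeg f K (m + k) := Nat.find_min hex (by omega)
  have hfx : f^[k] (f^[m + 1] x) = y := by
    rw [← iterate_add_apply, add_comm, ← hm, hjx]
  have hseg : f^[m + 1] x ∈ setOrbitSeg f K (m + 1) := mem_setOrbitSeg.2 ⟨_, le_rfl, x, hx, rfl⟩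
  refine ⟨m, by omega, ⟨hy.1, hym⟩, f^[m + 1] x,
    ⟨setOrbitSeg_subset_setOrbit _ hseg, fun h => hym ?_⟩, hseg, hfx⟩
  rw [← hfx]
  exact iterate_mem_setOrbitSeg h k

lemma setOrbitSeg_succ (n : ℕ) :
    setOrbitSeg f K (n + 1) = setOrbitSeg f K n ∪ f^[n + 1] '' K := by
  ext y
  simp only [mem_union, mem_setOrbitSeg, mem_image]
  constructor
  · rintro ⟨i, hi, h⟩
    rcases Nat.of_le_succ hi with h' | rfl
    · exact Or.inl ⟨i, h', h⟩
    · exact Or.inr h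
  · rintro (⟨i, hi, h⟩ | h)
    · exact ⟨i, by omega, h⟩
    · exact ⟨n + 1, le_rfl, h⟩

lemma setOrbitSeg_zero : setOrbitSeg f K 0 = K := by
  ext y; simp [mem_setOrbitSeg]

lemma evPeriodicPts_of_iterate {x : G} {i : ℕ} (h : f^[i] x ∈ evPeriodicPts f) :
    x ∈ evPeriodicPts f := by
  refine (((finite_lt_nat i).image fun n => f^[n] x).union h).subset ?_
  rintro _ ⟨n, rfl⟩
  rcases lt_or_ge n i with hn | hn
  · exact Or.inl ⟨n, hn, rfl⟩
  · exact Or.inr ⟨n - i, by simp only [← iterate_add_apply]; congr 2; omega⟩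

lemma evPeriodicPts_of_mapsTo_finite {k : ℕ} (hk : 0 < k) {F : Set G} (hF : F.Finite)
    (hmaps : MapsTo f^[k] F F) {x : G} (hx : x ∈ F) : x ∈ evPeriodicPts f := by
  refine ((finite_lt_nat k).biUnion fun j _ => hF.image f^[j]).subset ?_
  rintro _ ⟨n, rfl⟩
  refine mem_iUnion₂.2 ⟨n % k, Nat.mod_lt n hk, (f^[k])^[n / k] x, hmaps.iterate _ hx, ?_⟩
  rw [← iterate_mul, ← iterate_add_apply, Nat.mod_add_div]

lemma exists_isPeriodicPt_of_mapsTo_finite {g : G → G} {T : Set G} (hT : T.Finite)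
    (hne : T.Nonempty) (hg : MapsTo g T T) : ∃ τ ∈ T, ∃ l, 0 < l ∧ g^[l] τ = τ := by
  obtain ⟨x, hx⟩ := hne
  have := hT.to_subtype
  obtain ⟨i, j, hij, heq⟩ := Finite.exists_ne_map_eq_of_infinite
    fun i : ℕ => (⟨g^[i] x, hg.iterate i hx⟩ : T)
  wlog hlt : i < j generalizing i j
  · exact this j i hij.symm heq.symm (by omega)
  refine ⟨g^[i] x, hg.iterate i hx, j - i, by omega, ?_⟩
  rw [← iterate_add_apply, Nat.sub_add_cancel hlt.le]
  exact (congrArg Subtype.val heq).symm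

lemma setOrbit_disjoint_evPeriodicPts (hEP : K ∩ evPeriodicPts f = ∅) {y : G}
    (hy : y ∈ setOrbit f K) : y ∉ evPeriodicPts f := by
  obtain ⟨i, x, hx, rfl⟩ := mem_setOrbit.1 hy
  exact fun h => (hEP.subset ⟨hx, evPeriodicPts_of_iterate h⟩).elim

lemma iterate_ne_of_mem_setOrbit (hEP : K ∩ evPeriodicPts f = ∅) {y : G}
    (hy : y ∈ setOrbit f K) {k : ℕ} (hk : 0 < k) : f^[k] y ≠ y := fun h =>
  setOrbit_disjoint_evPeriodicPts hEP hy
    (evPeriodicPts_of_mapsTo_finite hk (finite_singleton y) (by simp [MapsTo, h]) rfl)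

lemma setOrbit_eq_of_orbitTail_eq_empty {n : ℕ} (h : orbitTail f K n = ∅) :
    setOrbit f K = setOrbitSeg f K n :=
  (sdiff_eq_empty.1 h).antisymm (setOrbitSeg_subset_setOrbit n)

lemma eventually_notMem_orbitTail (x : G) : ∀ᶠ n in atTop, x ∉ orbitTail f K n := by
  by_cases hx : x ∈ setOrbit f K
  · obtain ⟨N, hN⟩ := exists_mem_setOrbitSeg hx
    filter_upwards [eventually_ge_atTop N] with n hn hxn using hxn.2 (setOrbitSeg_mono hn hN)
  · exact Eventually.of_forall fun n hxn => hx hxn.1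

variable [MetricSpace G]

lemma isCompact_setOrbitSeg (hf : Continuous f) (hK : IsCompact K) (n : ℕ) :
    IsCompact (setOrbitSeg f K n) :=
  (finite_le_nat n).isCompact_biUnion fun i _ => hK.image (hf.iterate i)

lemma isConnected_setOrbitSeg (hf : Continuous f) (hK : IsConnected K)
    (hmeet : (f '' K ∩ K).Nonempty) (n : ℕ) : IsConnected (setOrbitSeg f K n) := by
  induction n with
  | zero => rwa [setOrbitSeg_zero]
  | succ n ih =>
    rw [setOrbitSeg_succ]
    refine ih.union ?_ (hK.image _ (hf.iterate _).continuousOn)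
    obtain ⟨_, ⟨x, hx, rfl⟩, hfx⟩ := hmeet
    exact ⟨f^[n] (f x), mem_setOrbitSeg.2 ⟨n, le_rfl, f x, hfx, rfl⟩, x, hx,
      iterate_succ_apply f n x⟩

lemma isConnected_setOrbit (hf : Continuous f) (hK : IsConnected K)
    (hmeet : (f '' K ∩ K).Nonempty) : IsConnected (setOrbit f K) := by
  refine ⟨hK.nonempty.mono subset_setOrbit, ?_⟩
  obtain ⟨x, hx⟩ := hK.nonempty
  refine isPreconnected_of_forall x fun y hy => ?_
  obtain ⟨n, hn⟩ := exists_mem_setOrbitSeg hy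
  exact ⟨_, setOrbitSeg_subset_setOrbit n, mem_setOrbitSeg.2 ⟨0, n.zero_le, x, hx, rfl⟩, hn,
    (isConnected_setOrbitSeg hf hK hmeet n).isPreconnected⟩

end Orbits

section BoundaryBumping

/-- Boundary bumping: in a continuum `X`, the closure of a component of the complement of a
nonempty closed subset `Y` meets `Y`. -/
lemma closure_connectedComponentIn_sdiff_inter_nonempty {G : Type*} [MetricSpace G]
    {X Y : Set G} (hXc : IsCompact X) (hX : IsPreconnected X) (hY : IsClosed Y)
    (hXY : (X ∩ Y).Nonempty) {τ : G} (hτ : τ ∈ X \ Y) :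
    (closure (connectedComponentIn (X \ Y) τ) ∩ Y).Nonempty := by
  by_contra hempty
  set H := connectedComponentIn (X \ Y) τ with hH
  have hτH : τ ∈ H := mem_connectedComponentIn hτ
  obtain ⟨Z, hZ, hHZ, hZY⟩ := normal_exists_closure_subset isClosed_closure hY.isOpen_compl
    (fun y hy hyY => hempty ⟨y, hy, hyY⟩)
  have hHX : H ⊆ X := (connectedComponentIn_subset _ _).trans sdiff_subset
  set S : Set G := X ∩ closure Z with hS
  have hSc : IsCompact S := hXc.inter_right isClosed_closure
  have : CompactSpace S := isCompact_iff_compactSpace.1 hSc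
  have hτS : τ ∈ S := ⟨hτ.1, subset_closure (hHZ (subset_closure hτH))⟩
  set σ : S := ⟨τ, hτS⟩
  have hcomp : Subtype.val '' connectedComponent σ ⊆ Z := by
    have h1 : Subtype.val '' connectedComponent σ ⊆ H := by
      refine (isPreconnected_connectedComponent.image _
        continuous_subtype_val.continuousOn).subset_connectedComponentIn
        ⟨σ, mem_connectedComponent, rfl⟩ ?_
      rintro _ ⟨⟨y, hyX, hyZ⟩, -, rfl⟩
      exact ⟨hyX, hZY hyZ⟩
    exact h1.trans (subset_closure.trans hHZ)
  obtain ⟨⟨Q, hQ, hσQ⟩, hQZ⟩ : ∃ Q : { s : Set S // IsClopen s ∧ σ ∈ s },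
      (Q : Set S) ⊆ Subtype.val ⁻¹' Z := by
    have : Nonempty { s : Set S // IsClopen s ∧ σ ∈ s } := ⟨⟨univ, isClopen_univ, mem_univ _⟩⟩
    refine exists_subset_nhds_of_compactSpace ?_ (fun Q => Q.2.1.isClosed) ?_
    · intro A B
      exact ⟨⟨A.1 ∩ B.1, A.2.1.inter B.2.1, A.2.2, B.2.2⟩, inter_subset_left,
        inter_subset_right⟩
    · intro y hy
      rw [← connectedComponent_eq_iInter_isClopen] at hy
      exact (hZ.preimage continuous_subtype_val).mem_nhds (hcomp ⟨y, hy, rfl⟩)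
  obtain ⟨W, hW, hWQ⟩ := isOpen_induced_iff.1 hQ.isOpen
  have hmem : ∀ y (hy : y ∈ S), (⟨y, hy⟩ : S) ∈ Q ↔ y ∈ W := fun y hy => by rw [← hWQ]; rfl
  have hQcl : IsClosed (Subtype.val '' Q) :=
    (hQ.isClosed.isCompact.image continuous_subtype_val).isClosed
  have hXZ : X ⊆ W ∩ Z := by
    refine (isPreconnected_iff_subset_of_disjoint.1 hX _ _ (hW.inter hZ) hQcl.isOpen_compl
      ?_ ?_).resolve_right fun h => h hτ.1 ⟨_, hσQ, rfl⟩
    · intro y _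
      refine or_iff_not_imp_right.2 fun hy => ?_
      obtain ⟨⟨y, hyS⟩, hyQ, rfl⟩ := not_not.1 hy
      exact ⟨(hmem y hyS).1 hyQ, hQZ hyQ⟩
    · refine eq_empty_of_forall_notMem ?_
      rintro y ⟨hyX, ⟨hyW, hyZ⟩, hyQ⟩
      exact hyQ ⟨⟨y, hyX, subset_closure hyZ⟩, (hmem y _).2 hyW, rfl⟩
  obtain ⟨y, hyX, hyY⟩ := hXY
  exact hZY (subset_closure (hXZ hyX).2) hyY

end BoundaryBumping

section Tips

variable {G : Type*} [MetricSpace G] {f : G → G} {K : Set G} {n : ℕ}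

/-- The points at which the orbit of `K` keeps growing. -/
def orbitTips (f : G → G) (K : Set G) : Set G := ⋂ n, closure (orbitTail f K n)

/-- A continuum without eventually periodic points, meeting its image, whose orbit never
stabilizes. -/
structure HasEndlessOrbit (f : G → G) (K : Set G) : Prop where
  continuous : Continuous f
  isClosed : IsClosed K
  isConnected : IsConnected K
  image_inter_nonempty : (f '' K ∩ K).Nonempty
  inter_evPeriodicPts : K ∩ evPeriodicPts f = ∅
  orbitTail_nonempty : ∀ n, (orbitTail f K n).Nonempty

lemma closure_orbitTail_antitone : Antitone fun n => closure (orbitTail f K n) := fun _ _ h =>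
  closure_mono (orbitTail_antitone h)

lemma orbitTips_subset_closure (n : ℕ) : orbitTips f K ⊆ closure (orbitTail f K n) :=
  iInter_subset _ n

namespace HasEndlessOrbit

lemma isConnected_setOrbitSeg (h : HasEndlessOrbit f K) (n : ℕ) :
    IsConnected (setOrbitSeg f K n) :=
  _root_.isConnected_setOrbitSeg h.continuous h.isConnected h.image_inter_nonempty n

lemma isConnected_setOrbit (h : HasEndlessOrbit f K) : IsConnected (setOrbit f K) :=
  _root_.isConnected_setOrbit h.continuous h.isConnected h.image_inter_nonempty

lemma iterate_ne (h : HasEndlessOrbit f K) {y : G} (hy : y ∈ setOrbit f K) {k : ℕ}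
    (hk : 0 < k) : f^[k] y ≠ y :=
  iterate_ne_of_mem_setOrbit h.inter_evPeriodicPts hy hk

variable [CompactSpace G]

lemma isClosed_setOrbitSeg (h : HasEndlessOrbit f K) (n : ℕ) : IsClosed (setOrbitSeg f K n) :=
  (isCompact_setOrbitSeg h.continuous h.isClosed.isCompact n).isClosed

lemma orbitTips_nonempty (h : HasEndlessOrbit f K) : (orbitTips f K).Nonempty :=
  IsCompact.nonempty_iInter_of_sequence_nonempty_isCompact_isClosed _
    (fun n => closure_orbitTail_antitone n.le_succ) (fun n => (h.orbitTail_nonempty n).closure)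
    isClosed_closure.isCompact fun _ => isClosed_closure

lemma orbitTips_subset_image (h : HasEndlessOrbit f K) : orbitTips f K ⊆ f '' orbitTips f K := by
  intro y hy
  have hcl (n : ℕ) : IsClosed (closure (orbitTail f K n) ∩ f ⁻¹' {y}) :=
    isClosed_closure.inter (isClosed_singleton.preimage h.continuous)
  have hne (n : ℕ) : (closure (orbitTail f K n) ∩ f ⁻¹' {y}).Nonempty := by
    have hsub : orbitTail f K (n + 1) ⊆ f '' closure (orbitTail f K n) := fun z hz => by
      obtain ⟨w, hw, rfl⟩ := exists_mem_orbitTail_apply_eq hz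
      exact ⟨w, subset_closure hw, rfl⟩
    exact closure_minimal hsub (isClosed_closure.isCompact.image h.continuous).isClosed
      (orbitTips_subset_closure _ hy)
  obtain ⟨x, hx⟩ := IsCompact.nonempty_iInter_of_sequence_nonempty_isCompact_isClosed _
    (fun n => inter_subset_inter_left _ (closure_orbitTail_antitone n.le_succ))
    hne (hcl 0).isCompact hcl
  rw [mem_iInter] at hx
  exact ⟨x, mem_iInter.2 fun n => (hx n).1, (hx 0).2⟩

lemma closure_setOrbit (h : HasEndlessOrbit f K) :
    closure (setOrbit f K) = setOrbit f K ∪ orbitTips f K := by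
  refine Subset.antisymm (fun x hx => or_iff_not_imp_left.2 fun hxO => mem_iInter.2 fun n => ?_)
    (union_subset subset_closure ((orbitTips_subset_closure 0).trans
      (closure_mono (orbitTail_subset 0))))
  rw [← union_sdiff_cancel (setOrbitSeg_subset_setOrbit (f := f) (K := K) n), closure_union,
    (h.isClosed_setOrbitSeg n).closure_eq] at hx
  exact hx.resolve_left fun hxs => hxO (setOrbitSeg_subset_setOrbit n hxs)

lemma finite_orbitTips (h : HasEndlessOrbit f K)
    (hG : ∃ M : ℕ, ∀ C : Set G, IsPreconnected C → (frontier C).encard ≤ M) :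
    (orbitTips f K).Finite := by
  obtain ⟨M, hM⟩ := hG
  rw [← inter_union_sdiff (orbitTips f K) (setOrbit f K)]
  refine Finite.union ?_ ?_
  · by_contra hinf
    obtain ⟨t, ht, htc⟩ := Set.Infinite.exists_subset_card_eq hinf (M + 1)
    obtain ⟨n, hn⟩ : ∃ n, (t : Set G) ⊆ setOrbitSeg f K n := by
      refine setOrbitSeg_mono.directed_le.exists_mem_subset_of_finset_subset_biUnion
        (α := G) (ι := ℕ) ?_
      intro x hx
      exact mem_iUnion.2 (exists_mem_setOrbitSeg (ht hx).2)
    have hfr : (t : Set G) ⊆ frontier (setOrbitSeg f K n) := by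
      refine fun x hx => ⟨subset_closure (hn hx), fun hint => ?_⟩
      obtain ⟨y, hy, hyD⟩ := mem_closure_iff.1 (orbitTips_subset_closure n (ht hx).1) _
        isOpen_interior hint
      exact hyD.2 (interior_subset hy)
    have := (encard_le_encard hfr).trans (hM _ (h.isConnected_setOrbitSeg n).isPreconnected)
    rw [encard_coe_eq_coe_finsetCard, htc] at this
    exact absurd (Nat.cast_le.1 this) (by omega)
  · refine (finite_of_encard_le_coe (hM _ h.isConnected_setOrbit.isPreconnected)).subset ?_
    rintro x ⟨hxT, hxO⟩
    refine ⟨?_, fun hx => hxO (interior_subset hx)⟩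
    rw [h.closure_setOrbit]
    exact Or.inr hxT

variable (h : HasEndlessOrbit f K) (hT : (orbitTips f K).Finite)
include h hT

lemma image_orbitTips : f '' orbitTips f K = orbitTips f K :=
  (eq_of_subset_of_ncard_le h.orbitTips_subset_image (ncard_image_le hT) (hT.image f)).symm

lemma mapsTo_orbitTips : MapsTo f (orbitTips f K) (orbitTips f K) :=
  mapsTo_iff_image_subset.2 (h.image_orbitTips hT).subset

lemma disjoint_setOrbit_orbitTips : Disjoint (setOrbit f K) (orbitTips f K) :=
  disjoint_left.2 fun _ hx hxT => setOrbit_disjoint_evPeriodicPts h.inter_evPeriodicPts hx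
    (evPeriodicPts_of_mapsTo_finite one_pos hT (h.mapsTo_orbitTips hT) hxT)

omit h hT in
lemma exists_closure_orbitTail_subset {W : Set G} (hW : IsOpen W) (hTW : orbitTips f K ⊆ W) :
    ∃ n, closure (orbitTail f K n) ⊆ W :=
  exists_subset_nhds_of_compactSpace closure_orbitTail_antitone.directed_ge
    (fun _ => isClosed_closure) fun _ hx => hW.mem_nhds (hTW hx)

omit h hT in
lemma eventually_disjoint_orbitTail {C : Set G} (hC : IsClosed C)
    (hCT : Disjoint C (orbitTips f K)) : ∀ᶠ n in atTop, Disjoint C (orbitTail f K n) := by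
  obtain ⟨N, hN⟩ := exists_closure_orbitTail_subset hC.isOpen_compl
    (fun x hx hxC => disjoint_left.1 hCT hxC hx)
  filter_upwards [eventually_ge_atTop N] with n hn
  exact disjoint_left.2 fun x hxC hx => hN (subset_closure (orbitTail_antitone hn hx)) hxC

lemma eventually_mapsTo_orbitTail (n : ℕ) :
    ∀ᶠ m in atTop, MapsTo f (orbitTail f K m) (orbitTail f K n) := by
  have hdisj : Disjoint (f ⁻¹' setOrbitSeg f K n) (orbitTips f K) :=
    disjoint_left.2 fun x hx hxT => disjoint_left.1 (h.disjoint_setOrbit_orbitTips hT)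
      (setOrbitSeg_subset_setOrbit n hx) (h.mapsTo_orbitTips hT hxT)
  filter_upwards [eventually_disjoint_orbitTail
    ((h.isClosed_setOrbitSeg n).preimage h.continuous) hdisj] with m hm x hx
  exact ⟨iterate_mem_setOrbit hx.1 1, fun hfx => disjoint_left.1 hm hfx hx⟩

lemma eventually_mapsTo_iterate_orbitTail (k n : ℕ) :
    ∀ᶠ m in atTop, MapsTo f^[k] (orbitTail f K m) (orbitTail f K n) := by
  induction k generalizing n with
  | zero =>
    filter_upwards [eventually_ge_atTop n] with m hm x hx using orbitTail_antitone hm hx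
  | succ k ih =>
    obtain ⟨l, hl⟩ := (h.eventually_mapsTo_orbitTail hT n).exists
    filter_upwards [ih l] with m hm x hx
    rw [iterate_succ_apply']
    exact hl (hm hx)

end HasEndlessOrbit

end Tips

section Rays

variable {G : Type*} [MetricSpace G] {f : G → G} {K : Set G}

/-- A connected set missing the frontier of a closed set lies inside it as soon as they meet. -/
lemma IsPreconnected.subset_of_disjoint_frontier {C X : Set G} (hC : IsPreconnected C)
    (hX : IsClosed X) (hCX : Disjoint C (frontier X)) (hmeet : (C ∩ X).Nonempty) : C ⊆ X := by
  obtain ⟨x, hxC, hxX⟩ := hmeet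
  refine ((isPreconnected_iff_subset_of_disjoint.1 hC _ _ isOpen_interior hX.isOpen_compl
    (fun y hy => ?_) ?_).resolve_right fun h => h hxC hxX).trans interior_subset
  · refine or_iff_not_imp_right.2 fun hyX => by_contra fun hyi => ?_
    exact disjoint_left.1 hCX hy ⟨subset_closure (not_not.1 hyX), hyi⟩
  · exact eq_empty_of_forall_notMem fun y hy => hy.2.2 (interior_subset hy.2.1)

/-- Finitely many disjoint open rays that carry the orbit of `K` beyond time `N`, each of them
being filled from its beginning towards its end. -/
structure IsRaySystem (f : G → G) (K : Set G) (R : Set (ℝ → G)) (N : ℕ) : Prop where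
  finite : R.Finite
  isOpenEmbedding : ∀ ρ ∈ R, IsOpenEmbedding ρ
  eq_of_apply_eq : ∀ ρ ∈ R, ∀ ρ' ∈ R, ∀ s t, ρ s = ρ' t → ρ = ρ'
  isUpperSet : ∀ ρ ∈ R, ∀ n ≥ N, IsUpperSet (ρ ⁻¹' orbitTail f K n)
  nonempty : ∀ ρ ∈ R, ∀ n, (ρ ⁻¹' orbitTail f K n).Nonempty
  cover : ∀ x ∈ orbitTail f K N, ∃ ρ ∈ R, ∃ t, ρ t = x

namespace HasEndlessOrbit

variable [CompactSpace G] (h : HasEndlessOrbit f K)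
include h

lemma isUpperSet_preimage_orbitTail {ψ : ℝ → G} (hψ : IsOpenEmbedding ψ)
    (hψT : Disjoint (range ψ) (orbitTips f K)) (hψO : range ψ ⊆ setOrbit f K) {n : ℕ}
    (hψ0 : ψ 0 ∈ setOrbitSeg f K n)
    (hne : ∀ m, ((fun t => ψ (Real.exp t)) ⁻¹' orbitTail f K m).Nonempty) :
    IsUpperSet ((fun t => ψ (Real.exp t)) ⁻¹' orbitTail f K n) := by
  intro s t hst hs
  refine ⟨hψO ⟨_, rfl⟩, fun ht => ?_⟩
  have hcomp : IsCompact (ψ '' Icc 0 (Real.exp t)) := isCompact_Icc.image hψ.continuous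
  obtain ⟨m, hm, hnm⟩ := ((eventually_disjoint_orbitTail hcomp.isClosed
    (hψT.mono_left (image_subset_range _ _))).and (eventually_ge_atTop n)).exists
  obtain ⟨r, hr⟩ := hne m
  have htr : Real.exp t < Real.exp r := by
    by_contra! hle
    exact disjoint_left.1 hm ⟨_, ⟨(Real.exp_pos r).le, hle⟩, rfl⟩ hr
  have hst' : Real.exp s ≤ Real.exp t := Real.exp_le_exp.2 hst
  have hrn : ψ (Real.exp r) ∉ setOrbitSeg f K n := (orbitTail_antitone hnm hr).2
  rcases (h.isConnected_setOrbitSeg n).isPreconnected.ordConnected_preimage_or hψ with hc | hc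
  · exact hs.2 (hc.out hψ0 ht ⟨(Real.exp_pos s).le, hst'⟩)
  · exact hc.out hs.2 hrn ⟨hst', htr.le⟩ ht

lemma exists_isRaySystem {V : Set G} {𝓔 : Set (ℝ → G)} (hE : IsEdgeAtlas V 𝓔)
    (hTV : orbitTips f K ⊆ V) (hXV : frontier (closure (setOrbit f K)) ⊆ V) :
    ∃ R N, IsRaySystem f K R N := by
  have hφT : ∀ φ ∈ 𝓔, Disjoint (range φ) (orbitTips f K) := fun φ hφ =>
    disjoint_left.2 fun x ⟨t, ht⟩ hx => hE.apply_notMem φ hφ t (ht ▸ hTV hx)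
  have hφO : ∀ φ ∈ 𝓔, ∀ t, φ t ∈ setOrbit f K → range φ ⊆ setOrbit f K := by
    intro φ hφ t ht x hx
    have hsub : range φ ⊆ closure (setOrbit f K) := by
      refine (isPreconnected_range (hE.isOpenEmbedding φ hφ).continuous).subset_of_disjoint_frontier
        isClosed_closure (disjoint_left.2 ?_) ⟨φ t, mem_range_self t, subset_closure ht⟩
      rintro _ ⟨s, rfl⟩ hs
      exact hE.apply_notMem φ hφ s (hXV hs)
    rw [h.closure_setOrbit] at hsub
    exact (hsub hx).resolve_right (disjoint_left.1 (hφT φ hφ) hx)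
  set S : Set ℝ := {1, -1}
  have hS : S.Finite := by simp [S]
  have hS0 : ∀ ε ∈ S, ε ≠ 0 := by simp [S]
  set ray : (ℝ → G) → ℝ → ℝ → G := fun φ ε t => φ (ε * Real.exp t)
  have hev : ∀ᶠ n in atTop, (∀ v ∈ V, v ∉ orbitTail f K n) ∧
      (∀ φ ∈ 𝓔, φ 0 ∉ orbitTail f K n) ∧
      ∀ φ ∈ 𝓔, ∀ ε ∈ S, (∀ m, (ray φ ε ⁻¹' orbitTail f K m).Nonempty) ∨
        ray φ ε ⁻¹' orbitTail f K n = ∅ := by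
    refine ((eventually_all_finite hE.finite_vertices).2 fun v _ =>
      eventually_notMem_orbitTail v).and (((eventually_all_finite hE.finite_edges).2
      fun φ _ => eventually_notMem_orbitTail _).and ((eventually_all_finite
      hE.finite_edges).2 fun φ _ => (eventually_all_finite hS).2 fun ε _ => ?_))
    by_cases hne : ∀ m, (ray φ ε ⁻¹' orbitTail f K m).Nonempty
    · exact Eventually.of_forall fun _ => Or.inl hne
    · push Not at hne
      obtain ⟨m, hm⟩ := hne
      filter_upwards [eventually_ge_atTop m] with n hn
      exact Or.inr (subset_eq_empty (preimage_mono (orbitTail_antitone hn)) hm)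
  obtain ⟨N, hNV, hN0, hNr⟩ := hev.exists
  refine ⟨{ρ | ∃ φ ∈ 𝓔, ∃ ε ∈ S, ray φ ε = ρ ∧ ∀ m, (ρ ⁻¹' orbitTail f K m).Nonempty}, N,
    ?_, ?_, ?_, ?_, ?_, ?_⟩
  · refine (hE.finite_edges.image2 ray hS).subset ?_
    rintro _ ⟨φ, hφ, ε, hε, rfl, -⟩
    exact mem_image2_of_mem hφ hε
  · rintro _ ⟨φ, hφ, ε, hε, rfl, -⟩
    exact (hE.isOpenEmbedding φ hφ).comp
      ((Homeomorph.mulLeft₀ ε (hS0 ε hε)).isOpenEmbedding.comp Real.isOpenEmbedding_exp)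
  · rintro _ ⟨φ, hφ, ε, hε, rfl, -⟩ _ ⟨φ', hφ', ε', hε', rfl, -⟩ s t hst
    obtain rfl := hE.eq_of_apply_eq φ hφ φ' hφ' _ _ hst
    have hst' := (hE.isOpenEmbedding φ hφ).injective hst
    have hs := Real.exp_pos s
    have ht := Real.exp_pos t
    rcases hε with rfl | rfl <;> rcases hε' with rfl | rfl <;> first | rfl | linarith
  · rintro _ ⟨φ, hφ, ε, hε, rfl, hne⟩ n hn
    have hrange : range (fun t => φ (ε * t)) ⊆ range φ := by
      rintro _ ⟨t, rfl⟩
      exact mem_range_self _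
    obtain ⟨t, ht⟩ := hne 0
    have hO := hφO φ hφ _ ht.1
    refine h.isUpperSet_preimage_orbitTail (ψ := fun t => φ (ε * t))
      ((hE.isOpenEmbedding φ hφ).comp (Homeomorph.mulLeft₀ ε (hS0 ε hε)).isOpenEmbedding)
      ((hφT φ hφ).mono_left hrange) (hrange.trans hO) ?_ hne
    have h0 := hN0 φ hφ
    rw [mul_zero]
    exact setOrbitSeg_mono hn (by_contra fun hcon => h0 ⟨hO (mem_range_self 0), hcon⟩)
  · rintro _ ⟨φ, hφ, ε, hε, rfl, hne⟩ n
    exact hne n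
  · intro x hx
    obtain ⟨φ, hφ, t, rfl⟩ := hE.cover x fun hxV => hNV x hxV hx
    obtain ⟨ε, hε, s, rfl⟩ : ∃ ε ∈ S, ∃ s, ε * Real.exp s = t := by
      rcases lt_trichotomy t 0 with ht | rfl | ht
      · exact ⟨-1, by simp [S], Real.log (-t), by rw [Real.exp_log (neg_pos.2 ht)]; ring⟩
      · exact absurd hx (hN0 φ hφ)
      · exact ⟨1, by simp [S], Real.log t, by rw [Real.exp_log ht, one_mul]⟩
    refine ⟨ray φ ε, ⟨φ, hφ, ε, hε, rfl, (hNr φ hφ ε hε).resolve_right fun he => ?_⟩, s, rfl⟩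
    exact he.subset (show s ∈ ray φ ε ⁻¹' orbitTail f K N from hx)

end HasEndlessOrbit

end Rays

section Trapping

variable {G : Type*} [MetricSpace G] [CompactSpace G] {f : G → G} {K : Set G}
  {R : Set (ℝ → G)} {N : ℕ}

namespace IsRaySystem

variable (hR : IsRaySystem f K R N) (h : HasEndlessOrbit f K) (hT : (orbitTips f K).Finite)
include hR h hT

lemma exists_eventually_apply_mem_range {ρ : ℝ → G} (hρ : ρ ∈ R) :
    ∃ σ ∈ R, ∀ᶠ n in atTop, ∀ t, ρ t ∈ orbitTail f K n → f (ρ t) ∈ range σ := by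
  obtain ⟨m, hm, hNm⟩ :=
    ((h.eventually_mapsTo_orbitTail hT N).and (eventually_ge_atTop N)).exists
  obtain ⟨t₀, ht₀⟩ := hR.nonempty ρ hρ m
  obtain ⟨σ, hσ, s₀, hs₀⟩ := hR.cover _ (hm ht₀)
  have hconn : IsPreconnected ((f ∘ ρ) '' (ρ ⁻¹' orbitTail f K m)) :=
    (hR.isUpperSet ρ hρ m hNm).ordConnected.isPreconnected.image _
      (h.continuous.comp (hR.isOpenEmbedding ρ hρ).continuous).continuousOn
  refine ⟨σ, hσ, ?_⟩
  have hsub : (f ∘ ρ) '' (ρ ⁻¹' orbitTail f K m) ⊆ range σ := by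
    refine (isPreconnected_iff_subset_of_disjoint.1 hconn _ (⋃ σ' ∈ R \ {σ}, range σ')
      (hR.isOpenEmbedding σ hσ).isOpen_range
      (isOpen_biUnion fun σ' hσ' => (hR.isOpenEmbedding σ' hσ'.1).isOpen_range)
      ?_ ?_).resolve_right fun hcon => ?_
    · rintro _ ⟨t, ht, rfl⟩
      obtain ⟨σ', hσ', s, hs⟩ := hR.cover _ (hm ht)
      by_cases hσσ : σ' = σ
      · exact Or.inl ⟨s, hσσ ▸ hs⟩
      · exact Or.inr (mem_iUnion₂.2 ⟨σ', ⟨hσ', hσσ⟩, s, hs⟩)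
    · refine eq_empty_of_forall_notMem ?_
      rintro y ⟨-, ⟨s, hs⟩, hy⟩
      obtain ⟨σ', hσ', s', hs'⟩ := mem_iUnion₂.1 hy
      exact hσ'.2 (hR.eq_of_apply_eq σ' hσ'.1 σ hσ s' s (hs'.trans hs.symm))
    · obtain ⟨σ', hσ', s', hs'⟩ := mem_iUnion₂.1 (hcon ⟨t₀, ht₀, rfl⟩)
      exact hσ'.2 (hR.eq_of_apply_eq σ' hσ'.1 σ hσ s' s₀ (hs'.trans hs₀.symm))
  filter_upwards [eventually_ge_atTop m] with n hn t ht
  exact hsub ⟨t, orbitTail_antitone hn ht, rfl⟩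

/-- Some iterate of `f` eventually maps each ray into itself. -/
lemma exists_eventually_iterate_mem_range :
    ∃ k, 0 < k ∧ ∀ᶠ n in atTop, ∀ ρ ∈ R, ∀ t, ρ t ∈ orbitTail f K n → f^[k] (ρ t) ∈ range ρ := by
  have := hR.finite.to_subtype
  have hex (ρ : R) : ∃ σ : R, ∀ᶠ n in atTop, ∀ t, ρ.1 t ∈ orbitTail f K n →
      f (ρ.1 t) ∈ range σ.1 := by
    obtain ⟨σ, hσ, hev⟩ := hR.exists_eventually_apply_mem_range h hT ρ.2
    exact ⟨⟨σ, hσ⟩, hev⟩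
  choose σ hσ using hex
  obtain ⟨l, hl, hNl⟩ := ((eventually_all.2 hσ).and (eventually_ge_atTop N)).exists
  have hsurj : Surjective σ := by
    rintro ⟨ρ', hρ'⟩
    obtain ⟨t, ht⟩ := hR.nonempty ρ' hρ' (l + 1)
    obtain ⟨z, hz, hzt⟩ := exists_mem_orbitTail_apply_eq ht
    obtain ⟨ρ, hρ, s, rfl⟩ := hR.cover z (orbitTail_antitone hNl hz)
    obtain ⟨r, hr⟩ := hl ⟨ρ, hρ⟩ s hz
    exact ⟨⟨ρ, hρ⟩, Subtype.ext (hR.eq_of_apply_eq _ (σ _).2 _ hρ' r t (hr.trans hzt))⟩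
  have hiter (j : ℕ) : ∀ᶠ n in atTop, ∀ ρ : R, ∀ t, ρ.1 t ∈ orbitTail f K n →
      f^[j] (ρ.1 t) ∈ range (σ^[j] ρ).1 := by
    induction j with
    | zero => exact Eventually.of_forall fun n ρ t _ => mem_range_self t
    | succ j ih =>
      filter_upwards [ih, h.eventually_mapsTo_iterate_orbitTail hT j l] with n hn hmaps ρ t ht
      obtain ⟨s, hs⟩ := hn ρ t ht
      rw [iterate_succ_apply', iterate_succ_apply', ← hs]
      refine hl _ s ?_
      rw [hs]
      exact hmaps ht
  set e : Equiv.Perm R := Equiv.ofBijective σ hsurj.bijective_of_finite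
  refine ⟨orderOf e, orderOf_pos e, ?_⟩
  filter_upwards [hiter (orderOf e)] with n hn ρ hρ t ht
  have hid : σ^[orderOf e] ⟨ρ, hρ⟩ = ⟨ρ, hρ⟩ := by
    change (⇑e)^[orderOf e] _ = _
    rw [← Equiv.Perm.coe_pow, pow_orderOf_eq_one, Equiv.Perm.one_apply]
  simpa only [hid] using hn ⟨ρ, hρ⟩ t ht

/-- Some iterate of `f` eventually maps the tails of the orbit into themselves. -/
lemma exists_eventually_mapsTo :
    ∃ k, 0 < k ∧ ∀ᶠ m in atTop, MapsTo f^[k] (orbitTail f K m) (orbitTail f K m) := by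
  obtain ⟨k, hk, hev⟩ := hR.exists_eventually_iterate_mem_range h hT
  obtain ⟨l, hl, hNl⟩ := (hev.and (eventually_ge_atTop N)).exists
  have key : ∀ ρ ∈ R, ∀ t, ρ t ∈ orbitTail f K l → ∃ t' > t, ρ t' = f^[k] (ρ t) := by
    intro ρ hρ
    choose! u hu using hl ρ hρ
    have hemb := hR.isOpenEmbedding ρ hρ
    have hcont : ContinuousOn u (ρ ⁻¹' orbitTail f K l) := by
      rw [hemb.isInducing.continuousOn_iff]
      exact ((h.continuous.iterate k).comp hemb.continuous).continuousOn.congr fun t ht => hu t ht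
    have hconn := (hR.isUpperSet ρ hρ l hNl).ordConnected.isPreconnected
    obtain ⟨s, hs, hsu⟩ : ∃ s ∈ ρ ⁻¹' orbitTail f K l, s ≤ u s := by
      obtain ⟨t₀, ht₀⟩ := hR.nonempty ρ hρ (l + k)
      obtain ⟨m, hlm, hm, z, hz, hzseg, hzt⟩ := exists_iterate_eq_of_mem_orbitTail ht₀
      have hzl := orbitTail_antitone hlm hz
      obtain ⟨ρ', hρ', s, rfl⟩ := hR.cover z (orbitTail_antitone hNl hzl)
      obtain ⟨r, hr⟩ := hl ρ' hρ' s hzl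
      obtain rfl := hR.eq_of_apply_eq ρ' hρ' ρ hρ r t₀ (hr.trans hzt)
      refine ⟨s, hzl, ?_⟩
      by_contra! hlt
      have husm : u s ∈ ρ' ⁻¹' orbitTail f K (m + 1) := by
        rw [mem_preimage, hu s hzl, hzt]
        exact orbitTail_antitone (by omega) hm
      exact (hR.isUpperSet ρ' hρ' (m + 1) (by omega) hlt.le husm).2 hzseg
    intro t ht
    refine ⟨u t, ?_, hu t ht⟩
    by_contra! hle
    obtain ⟨x, hx, hxu⟩ := hconn.intermediate_value₂ hs ht continuousOn_id hcont hsu hle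
    refine h.iterate_ne (orbitTail_subset l hx) hk ?_
    rw [← hu x hx, ← hxu, id]
  refine ⟨k, hk, ?_⟩
  filter_upwards [eventually_ge_atTop l] with m hm x hx
  have hxl := orbitTail_antitone hm hx
  obtain ⟨ρ, hρ, t, rfl⟩ := hR.cover x (orbitTail_antitone hNl hxl)
  obtain ⟨t', htt', ht'⟩ := key ρ hρ t hxl
  rw [← ht']
  exact hR.isUpperSet ρ hρ m (hNl.trans hm) htt'.le hx

end IsRaySystem

end Trapping

section Basin

variable {G : Type*} [MetricSpace G] [CompactSpace G] {f : G → G} {K : Set G} {m : ℕ}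

namespace HasEndlessOrbit

variable (h : HasEndlessOrbit f K) (hT : (orbitTips f K).Finite)
include h

omit [CompactSpace G] in
lemma mapsTo_closure_setOrbit : MapsTo f (closure (setOrbit f K)) (closure (setOrbit f K)) :=
  MapsTo.closure (fun _ hx => iterate_mem_setOrbit hx 1) h.continuous

include hT

lemma disjoint_setOrbitSeg_orbitTips (n : ℕ) : Disjoint (setOrbitSeg f K n) (orbitTips f K) :=
  (h.disjoint_setOrbit_orbitTips hT).mono_left (setOrbitSeg_subset_setOrbit n)

omit hT in
lemma mem_closure_orbitTail {x : G} (hx : x ∈ closure (setOrbit f K))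
    (hxm : x ∉ setOrbitSeg f K m) : x ∈ closure (orbitTail f K m) := by
  rw [h.closure_setOrbit] at hx
  rcases hx with hx | hx
  · exact subset_closure ⟨hx, hxm⟩
  · exact orbitTips_subset_closure m hx

lemma iterate_notMem_setOrbitSeg {k : ℕ}
    (hmaps : MapsTo f^[k] (orbitTail f K m) (orbitTail f K m)) {x : G}
    (hx : x ∈ closure (setOrbit f K)) (hxm : x ∉ setOrbitSeg f K m) :
    f^[k] x ∉ setOrbitSeg f K m := by
  rw [h.closure_setOrbit] at hx
  rcases hx with hx | hx
  · exact (hmaps ⟨hx, hxm⟩).2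
  · exact disjoint_right.1 (h.disjoint_setOrbitSeg_orbitTips hT m)
      ((h.mapsTo_orbitTips hT).iterate k hx)

variable (hG : ∃ M : ℕ, ∀ C : Set G, IsPreconnected C → (frontier C).encard ≤ M)
include hG

/-- If a tail of the orbit is mapped into itself by an iterate of `f`, then every point of the
closed orbit enters its closure. -/
lemma exists_iterate_notMem_setOrbitSeg {k : ℕ} (hk : 0 < k)
    (hmaps : MapsTo f^[k] (orbitTail f K m) (orbitTail f K m)) :
    ∃ i, ∀ x ∈ closure (setOrbit f K), (f^[k])^[i] x ∉ setOrbitSeg f K m := by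
  by_contra! hcon
  set X := closure (setOrbit f K) with hX
  set g := f^[k] with hg
  have hgc : Continuous g := h.continuous.iterate k
  have hgX : MapsTo g X X := h.mapsTo_closure_setOrbit.iterate k
  have hout : ∀ x ∈ X, x ∉ setOrbitSeg f K m → g x ∉ setOrbitSeg f K m := fun x hx =>
    h.iterate_notMem_setOrbitSeg hT hmaps hx
  set Z : ℕ → Set G := fun i => X ∩ g^[i] ⁻¹' setOrbitSeg f K m with hZ
  have hZcl (i : ℕ) : IsClosed (Z i) :=
    isClosed_closure.inter ((h.isClosed_setOrbitSeg m).preimage (hgc.iterate i))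
  set Y := ⋂ i, Z i with hY
  have hYcl : IsClosed Y := isClosed_iInter hZcl
  have hYne : Y.Nonempty := by
    refine IsCompact.nonempty_iInter_of_sequence_nonempty_isCompact_isClosed Z
      (fun i x hx => ⟨hx.1, ?_⟩) hcon (hZcl 0).isCompact hZcl
    by_contra hxi
    refine hout _ (hgX.iterate i hx.1) hxi ?_
    rw [← iterate_succ_apply' g]
    exact hx.2
  have hmemY : ∀ x, x ∈ Y ↔ x ∈ X ∧ ∀ i, g^[i] x ∈ setOrbitSeg f K m := fun x => by
    simp only [hY, hZ, mem_iInter, mem_inter_iff, mem_preimage, forall_and, forall_const]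
  have hgY : MapsTo g Y Y := fun x hx => by
    rw [hmemY] at hx ⊢
    exact ⟨hgX hx.1, fun i => hx.2 (i + 1)⟩
  have hgXY : MapsTo g (X \ Y) (X \ Y) := fun x ⟨hx, hxY⟩ => by
    refine ⟨hgX hx, fun hgx => hxY ?_⟩
    rw [hmemY] at hgx ⊢
    refine ⟨hx, fun i => ?_⟩
    cases i with
    | zero => exact by_contra fun hxm => hout x hx hxm (hgx.2 0)
    | succ i => exact hgx.2 i
  obtain ⟨τ, hτ, l, hl, hlτ⟩ := exists_isPeriodicPt_of_mapsTo_finite hT h.orbitTips_nonempty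
    ((h.mapsTo_orbitTips hT).iterate k)
  have hτXY : τ ∈ X \ Y := by
    refine ⟨?_, fun hτY => disjoint_right.1 (h.disjoint_setOrbitSeg_orbitTips hT m) hτ
      (((hmemY τ).1 hτY).2 0)⟩
    rw [hX, h.closure_setOrbit]
    exact Or.inr hτ
  set H := connectedComponentIn (X \ Y) τ with hH
  have hHH : MapsTo g^[l] H H := by
    refine mapsTo_iff_image_subset.2 ((isPreconnected_connectedComponentIn.image _
      (hgc.iterate l).continuousOn).subset_connectedComponentIn
      ⟨τ, mem_connectedComponentIn hτXY, hlτ⟩ ?_)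
    exact (image_mono (connectedComponentIn_subset _ _)).trans
      (mapsTo_iff_image_subset.1 (hgXY.iterate l))
  obtain ⟨y, hyH, hyY⟩ := closure_connectedComponentIn_sdiff_inter_nonempty
    isClosed_closure.isCompact h.isConnected_setOrbit.isPreconnected.closure hYcl
    (hYne.mono fun x hx => ⟨((hmemY x).1 hx).1, hx⟩) hτXY
  have hfin : (closure H ∩ Y).Finite := by
    obtain ⟨M, hM⟩ := hG
    refine (finite_of_encard_le_coe (hM H isPreconnected_connectedComponentIn)).subset ?_
    exact fun x hx => ⟨hx.1, fun hint =>
      (connectedComponentIn_subset _ _ (interior_subset hint)).2 hx.2⟩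
  have hinv : MapsTo f^[k * l] (closure H ∩ Y) (closure H ∩ Y) := by
    rw [iterate_mul]
    exact (hHH.closure (hgc.iterate l)).inter_inter (hgY.iterate l)
  exact setOrbit_disjoint_evPeriodicPts h.inter_evPeriodicPts
    (setOrbitSeg_subset_setOrbit m (((hmemY y).1 hyY).2 0))
    (evPeriodicPts_of_mapsTo_finite (Nat.mul_pos hk hl) hfin hinv ⟨hyH, hyY⟩)

omit [CompactSpace G] hT in
lemma exists_iterate_mem_interior {x : G} (hx : x ∈ setOrbit f K) :
    ∃ n, f^[n] x ∈ interior (closure (setOrbit f K)) := by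
  obtain ⟨M, hM⟩ := hG
  by_contra! hcon
  refine setOrbit_disjoint_evPeriodicPts h.inter_evPeriodicPts hx
    ((finite_of_encard_le_coe (hM _ h.isConnected_setOrbit.isPreconnected.closure)).subset ?_)
  rintro _ ⟨n, rfl⟩
  exact ⟨subset_closure (subset_closure (iterate_mem_setOrbit hx n)), hcon n⟩

omit hT in
lemma notMem_nonwanderingPts {k : ℕ} (hk : 0 < k)
    (hev : ∀ᶠ m in atTop, MapsTo f^[k] (orbitTail f K m) (orbitTail f K m)) {x : G}
    (hx : x ∈ setOrbit f K) : x ∉ nonwanderingPts f := by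
  intro hxΩ
  have hT := h.finite_orbitTips hG
  have hxT : x ∉ orbitTips f K := disjoint_left.1 (h.disjoint_setOrbit_orbitTips hT) hx
  obtain ⟨l, hl⟩ := exists_closure_orbitTail_subset (f := f) (K := K) isOpen_compl_singleton
    (subset_compl_singleton_iff.2 hxT)
  obtain ⟨m, hmaps, hlm⟩ := (hev.and (eventually_ge_atTop l)).exists
  have hxm : x ∉ closure (orbitTail f K m) := fun hxm => hl (closure_orbitTail_antitone hlm hxm) rfl
  obtain ⟨i, hi⟩ := h.exists_iterate_notMem_setOrbitSeg hT hG hk hmaps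
  have habs : ∀ n ≥ k * i, ∀ y ∈ closure (setOrbit f K), f^[n] y ∈ closure (orbitTail f K m) := by
    intro n hn y hy
    refine h.mem_closure_orbitTail (h.mapsTo_closure_setOrbit.iterate n hy) ?_
    rw [← Nat.add_sub_of_le hn, iterate_add_apply, iterate_mul]
    exact hi _ (h.mapsTo_closure_setOrbit.iterate _ hy)
  obtain ⟨N, hN⟩ := h.exists_iterate_mem_interior hG hx
  have hdisj : ∀ n ∈ Ioo 0 (N + k * i), ∀ᶠ U in (𝓝 x).smallSets, Disjoint (f^[n] '' U) U := by
    intro n hn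
    obtain ⟨P, Q, hP, hQ, hfP, hxQ, hPQ⟩ := t2_separation (h.iterate_ne hx hn.1)
    refine eventually_smallSets.2 ⟨f^[n] ⁻¹' P ∩ Q, ((hP.preimage
      (h.continuous.iterate n)).inter hQ).mem_nhds ⟨hfP, hxQ⟩, fun U hU => ?_⟩
    exact hPQ.mono (image_subset_iff.2 fun y hy => (hU hy).1) fun y hy => (hU hy).2
  obtain ⟨W, hW, hWp⟩ := eventually_smallSets.1
    ((eventually_all_finite (finite_Ioo 0 (N + k * i))).2 hdisj)
  have hmem : W ∩ ((closure (orbitTail f K m))ᶜ ∩ f^[N] ⁻¹' interior (closure (setOrbit f K)))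
      ∈ 𝓝 x := inter_mem hW ((isClosed_closure.isOpen_compl.inter
        (isOpen_interior.preimage (h.continuous.iterate N))).mem_nhds ⟨hxm, hN⟩)
  obtain ⟨U, hUsub, hU, hxU⟩ := _root_.mem_nhds_iff.1 hmem
  obtain ⟨n, hn, y, ⟨z, hz, rfl⟩, hy⟩ := hxΩ U hU hxU
  rcases lt_or_ge n (N + k * i) with hlt | hge
  · exact disjoint_left.1 (hWp U (hUsub.trans inter_subset_left) n ⟨hn, hlt⟩) ⟨z, hz, rfl⟩ hy
  · refine (hUsub hy).2.1 ?_
    rw [← Nat.sub_add_cancel (show N ≤ n by omega), iterate_add_apply]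
    exact habs _ (by omega) _ (interior_subset (hUsub hz).2.2)

end HasEndlessOrbit

end Basin

/-- if `K ∩ EP(f) = ∅` and `K ∩ Ω(f) ≠ ∅` for a connected closed set `K`
with `f(K) ∩ K ≠ ∅`, then the orbit `O(K,f)` equals some finite segment `O_n(K,f)`,
and in particular is closed. -/
theorem orbit_eventually_stabilizes {G : Type*} [MetricSpace G] (V : Set G)
    (hG : IsTopGraph V) (f : G → G) (hf : Continuous f) (K : Set G)
    (hKconn : IsConnected K) (hKclosed : IsClosed K)
    (hmeet : (f '' K ∩ K).Nonempty)
    (hEP : K ∩ evPeriodicPts f = ∅)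
    (hNW : (K ∩ nonwanderingPts f).Nonempty) :
    (∃ n : ℕ, 1 ≤ n ∧ setOrbit f K = setOrbitSeg f K n) ∧ IsClosed (setOrbit f K) := by
  have := hG.compact
  by_cases hne : ∀ n, (orbitTail f K n).Nonempty
  · exfalso
    have h : HasEndlessOrbit f K := ⟨hf, hKclosed, hKconn, hmeet, hEP, hne⟩
    obtain ⟨𝓔, hE⟩ := hG.exists_isEdgeAtlas
    have hfr := hE.exists_encard_frontier_le
    have hT := h.finite_orbitTips hfr
    obtain ⟨M, hM⟩ := hfr
    have hXfin : (frontier (closure (setOrbit f K))).Finite :=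
      finite_of_encard_le_coe (hM _ h.isConnected_setOrbit.isPreconnected.closure)
    obtain ⟨𝓔', hE'⟩ := hE.exists_union (hT.union hXfin)
    obtain ⟨R, N, hR⟩ := h.exists_isRaySystem hE'
      (subset_union_left.trans subset_union_left) (subset_union_right.trans subset_union_left)
    obtain ⟨k, hk, hev⟩ := hR.exists_eventually_mapsTo h hT
    obtain ⟨x, hxK, hx⟩ := hNW
    exact h.notMem_nonwanderingPts ⟨M, hM⟩ hk hev (subset_setOrbit hxK) hx
  · push Not at hne
    obtain ⟨n, hn⟩ := hne
    have hn' : orbitTail f K (n + 1) = ∅ := subset_eq_empty (orbitTail_antitone n.le_succ) hn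
    have heq := setOrbit_eq_of_orbitTail_eq_empty hn'
    exact ⟨⟨n + 1, by omega, heq⟩,
      heq ▸ (isCompact_setOrbitSeg hf hKclosed.isCompact (n + 1)).isClosed⟩
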